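/- For every j ∈ ℕ and all indices r ∈ Fin d, c ∈ Fin d, the (r, c) entry of the matrix C · Ā^j · B̄ equals Σ_{i ∈ Fin d_S} C_{r,i} · ((exp(λ_i Δ) − 1)/λ_i) · exp(λ_i · j · Δ). Consequently the state-space kernel Γ̄ = (C̄B̄, C̄ĀB̄, …, C̄Ā^{L−1}B̄) admits the closed form (C ⊙ E)·P, where E ∈ ℝ^{d_S} has entries E_i = (exp(λ_i Δ) − 1)/λ_i and P ∈ ℝ^{d_S × L} has entries P_{i,j} = exp(λ_i · j · Δ). -/

import Mathlib

/-- Closed form of the state-space kernel for the diagonally initialized state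
space layer: each entry of `C · Ā^j · B̄` equals
`Σ_i C_{r,i} · ((exp(λ_i Δ) − 1)/λ_i) · exp(λ_i · j · Δ)`, hence the kernel
`Γ̄ = (C̄B̄, C̄ĀB̄, …, C̄Ā^{L−1}B̄)` admits the closed form `(C ⊙ E)·P`. -/
theorem ssl_kernel_closed_form (dS d L : ℕ) (hdS : 0 < dS) (hd : 0 < d)
    (Δ : ℝ) (lam : Fin dS → ℝ) (hlam : ∀ i, lam i ≠ 0)
    (C : Matrix (Fin d) (Fin dS) ℝ)
    (Abar : Matrix (Fin dS) (Fin dS) ℝ)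
    (hAbar : Abar = Matrix.diagonal fun i => Real.exp (lam i * Δ))
    (B : Matrix (Fin dS) (Fin d) ℝ) (hB : B = Matrix.of fun _ _ => (1 : ℝ))
    (Bbar : Matrix (Fin dS) (Fin d) ℝ)
    (hBbar : Bbar = (Abar - 1) * Matrix.diagonal (fun i => (lam i)⁻¹) * B) :
    (∀ (j : ℕ) (r c : Fin d),
      (C * Abar ^ j * Bbar) r c =
        ∑ i, C r i * ((Real.exp (lam i * Δ) - 1) / lam i) * Real.exp (lam i * j * Δ)) ∧
    (∀ (j : Fin L) (r c : Fin d),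
      (C * Abar ^ (j : ℕ) * Bbar) r c =
        ((Matrix.of fun (r : Fin d) (i : Fin dS) =>
            C r i * ((Real.exp (lam i * Δ) - 1) / lam i)) *
          (Matrix.of fun (i : Fin dS) (j : Fin L) =>
            Real.exp (lam i * (j : ℕ) * Δ))) r j) := by
  have entry : ∀ (j : ℕ) (r c : Fin d), (C * Abar ^ j * Bbar) r c =
      ∑ i, C r i * ((Real.exp (lam i * Δ) - 1) / lam i) * Real.exp (lam i * j * Δ) := by
    intro j r c
    have hdiag : Abar - 1 = Matrix.diagonal fun i => Real.exp (lam i * Δ) - 1 := by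
      rw [hAbar, ← Matrix.diagonal_one, Matrix.diagonal_sub]
    rw [hBbar, hdiag, hAbar, hB, Matrix.diagonal_pow, Matrix.diagonal_mul_diagonal,
      Matrix.mul_apply]
    refine Finset.sum_congr rfl fun i _ => ?_
    have hexp : Real.exp (lam i * j * Δ) = Real.exp (lam i * Δ) ^ j := by
      rw [← Real.exp_nat_mul]
      ring_nf
    rw [Matrix.mul_diagonal, Matrix.diagonal_mul, hexp]
    simp only [Pi.pow_apply, Matrix.of_apply]
    ring
  refine ⟨entry, fun j r c => ?_⟩
  rw [entry, Matrix.mul_apply]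
  rfl
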